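/- Let T be a (1,β)-RK operator on a complex Banach space X with β > 0. Then ‖T^n‖ = O(n^β log n), i.e. there exist a constant M > 0 and N ∈ ℕ such that ‖T^n‖ ≤ M n^β log(n) for all n ≥ N. -/

import Mathlib

/-- A bounded linear operator `T` on a complex Banach space is `(α,β)`-RK with constant `C` if
`C ≥ 1` and for every `λ ∈ ℂ` with `|λ| > 1` the operator `λI − T` is invertible with
`‖(λI − T)⁻¹‖ ≤ C |λ|^(α+β−1) / (|λ−1|^α (|λ|−1)^β)`. -/
def IsRK {X : Type*} [NormedAddCommGroup X] [NormedSpace ℂ X]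
    (T : X →L[ℂ] X) (α β C : ℝ) : Prop :=
  1 ≤ C ∧ ∀ lam : ℂ, 1 < ‖lam‖ →
    IsUnit (algebraMap ℂ (X →L[ℂ] X) lam - T) ∧
    ‖Ring.inverse (algebraMap ℂ (X →L[ℂ] X) lam - T)‖ ≤
      C * ‖lam‖ ^ (α + β - 1) / (‖lam - 1‖ ^ α * (‖lam‖ - 1) ^ β)

/-- Cauchy's estimate for the powers of an element of a Banach algebra, in terms of the mean of
`‖(1 - z a)⁻¹‖` over the circle of radius `ρ`. -/
theorem norm_pow_le_circleAverage_inverse {A : Type*} [NormedRing A] [NormedAlgebra ℂ A]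
    [CompleteSpace A] (a : A) {ρ : ℝ} (hρ : 0 < ρ)
    (ha : ∀ z : ℂ, ‖z‖ ≤ ρ → IsUnit (1 - z • a)) (n : ℕ) :
    ‖a ^ n‖ ≤ ((2 * Real.pi)⁻¹ *
      ∫ θ : ℝ in 0..2 * Real.pi, ‖Ring.inverse (1 - circleMap 0 ρ θ • a)‖) * ρ⁻¹ ^ n := by
  lift ρ to NNReal using hρ.le
  have hd : DifferentiableOn ℂ (fun z : ℂ => Ring.inverse (1 - z • a))
      (Metric.closedBall 0 ρ) := by
    intro z hz
    apply DifferentiableAt.differentiableWithinAt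
    have hlin : Differentiable ℂ fun w : ℂ => 1 - w • a :=
      (differentiable_id.smul_const a).const_sub 1
    exact DifferentiableAt.comp z
      (differentiableAt_inverse (ha z (mem_closedBall_zero_iff.mp hz))) hlin.differentiableAt
  have hcauchy := (hd.hasFPowerSeriesOnBall (by exact_mod_cast hρ)).hasFPowerSeriesAt
  have heq := (spectrum.hasFPowerSeriesOnBall_inverse_one_sub_smul ℂ a).hasFPowerSeriesAt
    |>.eq_formalMultilinearSeries hcauchy
  have hbound := norm_cauchyPowerSeries_le (fun z : ℂ => Ring.inverse (1 - z • a)) 0 ρ n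
  rw [← heq, ContinuousMultilinearMap.norm_mkPiRing, abs_of_pos hρ] at hbound
  exact hbound

/-- The resolvent bound of an `(α,β)`-RK operator, transported to the punctured unit disc by
`z = λ⁻¹`, where the powers of `|λ|` cancel when `α = 1`. -/
theorem IsRK.norm_inverse_one_sub_smul_le {X : Type*} [NormedAddCommGroup X] [NormedSpace ℂ X]
    {T : X →L[ℂ] X} {β C : ℝ} (hT : IsRK T 1 β C) {z : ℂ} (hz0 : z ≠ 0) (hz : ‖z‖ < 1) :
    IsUnit (1 - z • T) ∧
      ‖Ring.inverse (1 - z • T)‖ ≤ C * ((1 - ‖z‖) ^ β)⁻¹ * ‖1 - z‖⁻¹ := by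
  have hzpos : 0 < ‖z‖ := norm_pos_iff.mpr hz0
  have hlam : 1 < ‖z⁻¹‖ := by rw [norm_inv]; exact (one_lt_inv₀ hzpos).mpr hz
  obtain ⟨hu, hb⟩ := hT.2 z⁻¹ hlam
  have hfac : 1 - z • T
      = algebraMap ℂ (X →L[ℂ] X) z * (algebraMap ℂ (X →L[ℂ] X) z⁻¹ - T) := by
    rw [mul_sub, ← map_mul, mul_inv_cancel₀ hz0, map_one, Algebra.smul_def]
  have hzu : IsUnit (algebraMap ℂ (X →L[ℂ] X) z) := (IsUnit.mk0 z hz0).map _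
  have hunit : IsUnit (1 - z • T) := by rw [hfac]; exact hzu.mul hu
  have hinv : Ring.inverse (1 - z • T)
      = z⁻¹ • Ring.inverse (algebraMap ℂ (X →L[ℂ] X) z⁻¹ - T) := by
    rw [← one_mul (Ring.inverse (1 - z • T)), eq_comm, Ring.eq_mul_inverse_iff_mul_eq _ _ _ hunit,
      hfac, ← Algebra.smul_def, smul_mul_smul_comm, inv_mul_cancel₀ hz0, one_smul,
      Ring.inverse_mul_cancel _ hu]
  refine ⟨hunit, ?_⟩
  have hsub : ‖z⁻¹ - 1‖ = ‖1 - z‖ / ‖z‖ := by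
    rw [← norm_div]; congr 1; field_simp
  have hsub' : ‖z‖⁻¹ - 1 = (1 - ‖z‖) / ‖z‖ := by field_simp
  have h1z : 0 < 1 - ‖z‖ := by linarith
  have hne : 0 < ‖1 - z‖ := by
    refine norm_pos_iff.mpr (sub_ne_zero.mpr ?_)
    rintro rfl
    simp at hz
  have hpow : 0 < ‖z‖ ^ β := Real.rpow_pos_of_pos hzpos β
  have hpow' : 0 < (1 - ‖z‖) ^ β := Real.rpow_pos_of_pos h1z β
  rw [hinv, norm_smul, norm_inv]
  refine (mul_le_mul_of_nonneg_left hb (by positivity)).trans_eq ?_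
  rw [hsub, norm_inv, hsub', Real.rpow_one, Real.div_rpow h1z.le hzpos.le, add_sub_cancel_left,
    Real.inv_rpow hzpos.le]
  field_simp

/-- A lower bound for the distance from `1` to the circle of radius `ρ`, for angles up to `π`. -/
theorem add_le_pi_mul_norm_one_sub_circleMap {ρ θ : ℝ} (hρ : 1 / 2 ≤ ρ)
    (hθ : 0 ≤ θ) (hθ' : θ ≤ Real.pi) :
    (1 - ρ) + θ ≤ Real.pi * ‖1 - circleMap 0 ρ θ‖ := by
  have hpi := Real.pi_gt_three
  have hsin : θ / Real.pi ≤ Real.sin (θ / 2) := by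
    refine le_trans (le_of_eq ?_) (Real.mul_le_sin (x := θ / 2) (by linarith) (by linarith))
    field_simp
  have hcos : Real.cos θ = 1 - 2 * Real.sin (θ / 2) ^ 2 := by
    have h := Real.cos_two_mul (θ / 2)
    rw [mul_div_cancel₀ θ two_ne_zero] at h
    linarith [Real.sin_sq_add_cos_sq (θ / 2)]
  have hnorm : ‖1 - circleMap 0 ρ θ‖ ^ 2 = (1 - ρ) ^ 2 + 4 * ρ * Real.sin (θ / 2) ^ 2 := by
    rw [Complex.sq_norm, Complex.normSq_apply]
    simp only [circleMap, zero_add, Complex.sub_re, Complex.sub_im, Complex.one_re, Complex.one_im,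
      Complex.re_ofReal_mul, Complex.im_ofReal_mul, Complex.exp_ofReal_mul_I_re,
      Complex.exp_ofReal_mul_I_im]
    linear_combination ρ ^ 2 * Real.sin_sq_add_cos_sq θ - 2 * ρ * hcos
  have hdiv : 0 ≤ θ / Real.pi := by positivity
  have hmul : θ = Real.pi * (θ / Real.pi) := by field_simp
  generalize θ / Real.pi = t at *
  generalize Real.sin (θ / 2) = s at *
  have hts : t ^ 2 ≤ s ^ 2 := pow_le_pow_left₀ hdiv hsin 2
  have hlow : (1 - ρ) ^ 2 + 2 * t ^ 2 ≤ ‖1 - circleMap 0 ρ θ‖ ^ 2 := by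
    rw [hnorm]; nlinarith [sq_nonneg s]
  refine le_of_sq_le_sq ?_ (by positivity)
  rw [mul_pow]
  refine le_trans ?_ (mul_le_mul_of_nonneg_left hlow (by positivity))
  have h2 : ((1 - ρ) + θ) ^ 2 ≤ 2 * (1 - ρ) ^ 2 + 2 * θ ^ 2 := by
    nlinarith [sq_nonneg (1 - ρ - θ)]
  have h3 : θ ^ 2 = Real.pi ^ 2 * t ^ 2 := by rw [hmul, mul_pow]
  have h4 : 2 * (1 - ρ) ^ 2 ≤ Real.pi ^ 2 * (1 - ρ) ^ 2 :=
    mul_le_mul_of_nonneg_right (by nlinarith) (sq_nonneg _)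
  linarith

theorem norm_one_sub_circleMap_two_pi_sub (ρ θ : ℝ) :
    ‖1 - circleMap 0 ρ (2 * Real.pi - θ)‖ = ‖1 - circleMap 0 ρ θ‖ := by
  rw [← Complex.norm_conj (1 - circleMap 0 ρ θ)]
  congr 1
  apply Complex.ext <;>
    simp [circleMap, -Complex.ofReal_sub, -Complex.ofReal_mul, Complex.exp_ofReal_mul_I_re,
      Complex.exp_ofReal_mul_I_im, Real.cos_two_pi_sub, Real.sin_two_pi_sub]

theorem inv_norm_one_sub_circleMap_le {ρ θ : ℝ} (hρ : 1 / 2 ≤ ρ) (hρ1 : ρ < 1)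
    (hθ : 0 ≤ θ) (hθ' : θ ≤ 2 * Real.pi) :
    ‖1 - circleMap 0 ρ θ‖⁻¹ ≤
      Real.pi * (((1 - ρ) + θ)⁻¹ + ((1 - ρ + 2 * Real.pi) - θ)⁻¹) := by
  have hpi := Real.pi_pos
  have key : ∀ φ : ℝ, 0 ≤ φ → φ ≤ Real.pi →
      ‖1 - circleMap 0 ρ φ‖⁻¹ ≤ Real.pi * ((1 - ρ) + φ)⁻¹ := by
    intro φ h0 h1
    have h := add_le_pi_mul_norm_one_sub_circleMap hρ h0 h1
    have hp : 0 < (1 - ρ) + φ := by linarith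
    rw [← div_eq_mul_inv, ← inv_div]
    refine inv_anti₀ (by positivity) ?_
    rwa [div_le_iff₀' hpi]
  have hl : 0 ≤ ((1 - ρ) + θ)⁻¹ := inv_nonneg.mpr (by linarith)
  have hr : 0 ≤ ((1 - ρ + 2 * Real.pi) - θ)⁻¹ := inv_nonneg.mpr (by linarith)
  rw [mul_add]
  rcases le_total θ Real.pi with h | h
  · exact (key θ hθ h).trans (le_add_of_nonneg_right (by positivity))
  · have := key (2 * Real.pi - θ) (by linarith) (by linarith)
    rw [norm_one_sub_circleMap_two_pi_sub, ← add_sub_assoc] at this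
    exact this.trans (le_add_of_nonneg_left (by positivity))

theorem integral_inv_add_add_inv_sub {a : ℝ} (ha : 0 < a) :
    IntervalIntegrable (fun θ : ℝ => (a + θ)⁻¹ + ((a + 2 * Real.pi) - θ)⁻¹)
        MeasureTheory.volume 0 (2 * Real.pi) ∧
      ∫ θ : ℝ in 0..2 * Real.pi, ((a + θ)⁻¹ + ((a + 2 * Real.pi) - θ)⁻¹)
        = 2 * Real.log ((a + 2 * Real.pi) / a) := by
  have hpi := Real.pi_pos
  have hi1 : IntervalIntegrable (fun θ : ℝ => (a + θ)⁻¹) MeasureTheory.volume 0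
      (2 * Real.pi) := by
    refine ContinuousOn.intervalIntegrable fun θ hθ => ?_
    rw [Set.uIcc_of_le (by positivity)] at hθ
    have : a + θ ≠ 0 := by linarith [hθ.1]
    exact ContinuousAt.continuousWithinAt (by fun_prop (disch := assumption))
  have hi2 : IntervalIntegrable (fun θ : ℝ => ((a + 2 * Real.pi) - θ)⁻¹) MeasureTheory.volume 0
      (2 * Real.pi) := by
    refine ContinuousOn.intervalIntegrable fun θ hθ => ?_
    rw [Set.uIcc_of_le (by positivity)] at hθ
    have : (a + 2 * Real.pi) - θ ≠ 0 := by linarith [hθ.2]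
    exact ContinuousAt.continuousWithinAt (by fun_prop (disch := assumption))
  refine ⟨hi1.add hi2, ?_⟩
  rw [intervalIntegral.integral_add hi1 hi2,
    intervalIntegral.integral_comp_add_left (fun x : ℝ => x⁻¹),
    intervalIntegral.integral_comp_sub_left (fun x : ℝ => x⁻¹), add_zero, sub_zero,
    add_sub_cancel_right, integral_inv_of_pos ha (by positivity)]
  ring

theorem IsRK.norm_pow_le {X : Type*} [NormedAddCommGroup X] [NormedSpace ℂ X] [CompleteSpace X]
    {T : X →L[ℂ] X} {β C : ℝ} (hT : IsRK T 1 β C) {ρ : ℝ} (hρ : 1 / 2 ≤ ρ) (hρ1 : ρ < 1)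
    (n : ℕ) :
    ‖T ^ n‖ ≤ C * ((1 - ρ) ^ β)⁻¹ * Real.log ((1 - ρ + 2 * Real.pi) / (1 - ρ)) * ρ⁻¹ ^ n := by
  have hpi := Real.pi_pos
  have hρ0 : 0 < ρ := by linarith
  have hC : 0 ≤ C := zero_le_one.trans hT.1
  have hK : 0 ≤ C * ((1 - ρ) ^ β)⁻¹ :=
    mul_nonneg hC (inv_nonneg.mpr (Real.rpow_nonneg (by linarith) β))
  have hunit : ∀ z : ℂ, ‖z‖ ≤ ρ → IsUnit (1 - z • T) := by
    intro z hz
    rcases eq_or_ne z 0 with rfl | hz0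
    · simp
    · exact (hT.norm_inverse_one_sub_smul_le hz0 (hz.trans_lt hρ1)).1
  refine (norm_pow_le_circleAverage_inverse T hρ0 hunit n).trans ?_
  refine mul_le_mul_of_nonneg_right ?_ (by positivity)
  obtain ⟨hint, hval⟩ := integral_inv_add_add_inv_sub (a := 1 - ρ) (by linarith)
  have hle : ∫ θ : ℝ in 0..2 * Real.pi, ‖Ring.inverse (1 - circleMap 0 ρ θ • T)‖ ≤
      ∫ θ : ℝ in 0..2 * Real.pi, (C * ((1 - ρ) ^ β)⁻¹ * Real.pi) *
        (((1 - ρ) + θ)⁻¹ + ((1 - ρ + 2 * Real.pi) - θ)⁻¹) := by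
    refine (Real.le_norm_self _).trans (intervalIntegral.norm_integral_le_of_norm_le
      (by positivity) (Filter.Eventually.of_forall fun θ hθ => ?_) (hint.const_mul _))
    have hnorm : ‖circleMap 0 ρ θ‖ = ρ := by rw [norm_circleMap_zero, abs_of_pos hρ0]
    have hb := (hT.norm_inverse_one_sub_smul_le (z := circleMap 0 ρ θ)
      (circleMap_ne_center hρ0.ne') (by rwa [hnorm])).2
    rw [hnorm] at hb
    rw [norm_norm, mul_assoc _ Real.pi]
    exact hb.trans (mul_le_mul_of_nonneg_left
      (inv_norm_one_sub_circleMap_le hρ hρ1 hθ.1.le hθ.2) hK)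
  rw [intervalIntegral.integral_const_mul, hval] at hle
  refine (mul_le_mul_of_nonneg_left hle (by positivity)).trans_eq ?_
  field_simp

/-- For a `(1,β)`-RK operator with `β > 0`, `‖T^n‖ = O(n^β log n)`. -/
theorem power_norm_O_nbeta_log
    {X : Type*} [NormedAddCommGroup X] [NormedSpace ℂ X] [CompleteSpace X]
    (T : X →L[ℂ] X) (β C : ℝ) (hβ : 0 < β) (hT : IsRK T 1 β C) :
    ∃ M > (0 : ℝ), ∃ N : ℕ, ∀ n : ℕ, N ≤ n →
      ‖T ^ n‖ ≤ M * (n : ℝ) ^ β * Real.log n := by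
  have hC : 0 < C := zero_lt_one.trans_le hT.1
  refine ⟨C * 2 ^ β * 5 * Real.exp 1, by positivity, 2, fun n hn => ?_⟩
  have hn2 : (2 : ℝ) ≤ n := by exact_mod_cast hn
  have hn0 : (0 : ℝ) < n := by linarith
  have hsub : 1 - (n : ℝ) / (n + 1) = (n + 1 : ℝ)⁻¹ := by field_simp; ring
  have hmain := hT.norm_pow_le (ρ := (n : ℝ) / (n + 1))
    (by rw [div_le_div_iff₀ (by norm_num) (by positivity)]; linarith)
    (by rw [div_lt_one (by positivity)]; linarith) n
  rw [hsub, Real.inv_rpow (by positivity), inv_inv, inv_div] at hmain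
  have hgrowth : ((n + 1 : ℝ) ^ β) ≤ 2 ^ β * (n : ℝ) ^ β := by
    rw [← Real.mul_rpow (by norm_num) hn0.le]
    exact Real.rpow_le_rpow (by positivity) (by linarith) hβ.le
  have hlog : Real.log (((n + 1 : ℝ)⁻¹ + 2 * Real.pi) / (n + 1 : ℝ)⁻¹) ≤ 5 * Real.log n := by
    rw [show (5 : ℝ) * Real.log n = Real.log ((n : ℝ) ^ 5) by rw [Real.log_pow]; norm_num]
    refine Real.log_le_log (by positivity) ?_
    have hpi := Real.pi_lt_d2
    have h4 : (2 : ℝ) ^ 4 ≤ (n : ℝ) ^ 4 := pow_le_pow_left₀ (by norm_num) hn2 4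
    calc ((n + 1 : ℝ)⁻¹ + 2 * Real.pi) / (n + 1 : ℝ)⁻¹
        = 1 + 2 * Real.pi * (n + 1) := by field_simp
      _ ≤ 2 ^ 4 * n := by nlinarith
      _ ≤ (n : ℝ) ^ 4 * n := by gcongr
      _ = (n : ℝ) ^ 5 := by ring
  have hexp : ((n + 1 : ℝ) / n) ^ n ≤ Real.exp 1 := by
    calc ((n + 1 : ℝ) / n) ^ n ≤ Real.exp (1 / n) ^ n := by
          refine pow_le_pow_left₀ (by positivity) ?_ n
          refine le_trans (le_of_eq ?_) (Real.add_one_le_exp _)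
          field_simp
          ring
      _ = Real.exp 1 := by rw [← Real.exp_nat_mul]; congr 1; field_simp
  have hlog0 : 0 ≤ Real.log n := Real.log_nonneg (by linarith)
  have hlog1 : 0 ≤ Real.log (((n + 1 : ℝ)⁻¹ + 2 * Real.pi) / (n + 1 : ℝ)⁻¹) := by
    refine Real.log_nonneg ((one_le_div (by positivity)).mpr ?_)
    linarith [Real.pi_pos]
  calc ‖T ^ n‖ ≤ _ := hmain
    _ ≤ C * (2 ^ β * (n : ℝ) ^ β) * (5 * Real.log n) * Real.exp 1 := by gcongr
    _ = C * 2 ^ β * 5 * Real.exp 1 * (n : ℝ) ^ β * Real.log n := by ring
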